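/- For every multi-index k ∈ ℕ^d, every 1 ≤ l ≤ d, and every x ∈ ℝ^d, the polynomials P_k satisfy the recursion P_{k+e_l}(A,ℏ,x) = (2/√ℏ) ⟨ A e_l, (A A*)⁻¹ x ⟩ · P_k(A,ℏ,x) − √ℏ · ⟨ A e_l, ∇_x P_k(A,ℏ,x) ⟩, where e_l is the l-th standard basis vector and ∇_x P_k is the gradient of x ↦ P_k(A,ℏ,x). -/

import Mathlib

open Matrix Complex

noncomputable section

/-- The pairing `⟨a, b⟩ = ∑ j, conj (a j) * b j` on `ℂ^d`. -/
def cinner {d : ℕ} (a b : Fin d → ℂ) : ℂ := ∑ j, (starRingEnd ℂ) (a j) * b j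

/-- The embedding of `ℝ^d` into `ℂ^d`. -/
def cvec {d : ℕ} (x : Fin d → ℝ) : Fin d → ℂ := fun j => (x j : ℂ)

/-- The `l`-th standard basis vector of `ℂ^d`. -/
def stdC {d : ℕ} (l : Fin d) : Fin d → ℂ := Pi.single l 1

/-- The gradient of `ψ : ℝ^d → ℂ`, viewed as the vector of partial derivatives. -/
def grad {d : ℕ} (ψ : (Fin d → ℝ) → ℂ) (x : Fin d → ℝ) : Fin d → ℂ :=
  fun j => fderiv ℝ ψ x (Pi.single j 1)

/-- The raising operator `R_l` built from `(A, B)` at semiclassical parameter `h`. -/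
def raiseOp {d : ℕ} (A B : Matrix (Fin d) (Fin d) ℂ) (h : ℝ) (l : Fin d)
    (ψ : (Fin d → ℝ) → ℂ) : (Fin d → ℝ) → ℂ := fun x =>
  ((Real.sqrt (2 * h) : ℝ) : ℂ)⁻¹ *
    (cinner (B.mulVec (stdC l)) (cvec x) * ψ x
      - (h : ℂ) * cinner (A.mulVec (stdC l)) (grad ψ x))

/-- The ground state Gaussian `φ₀`, where `sqrtA` is a fixed branch of `√(det A)`. -/
def phi0 {d : ℕ} (A B : Matrix (Fin d) (Fin d) ℂ) (h : ℝ) (sqrtA : ℂ)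
    (x : Fin d → ℝ) : ℂ :=
  ((Real.pi ^ (-(d : ℝ) / 4) * h ^ (-(d : ℝ) / 4) : ℝ) : ℂ) * sqrtA⁻¹ *
    Complex.exp (-(cinner (cvec x) ((B * A⁻¹).mulVec (cvec x)) / ((2 * h : ℝ) : ℂ)))

/-- `R_1^{k_1} ∘ ⋯ ∘ R_d^{k_d}` for a family of operators `R` and a multi-index `k`. -/
def opPow {d : ℕ} {α : Type*} (R : Fin d → (α → α)) (k : Fin d → ℕ) : α → α :=
  (List.finRange d).foldr (fun l f => (R l)^[k l] ∘ f) id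

/-- The polynomials `P_k(A, h, x)`:
`P_k = 2^{|k|/2} (R_1^{k_1} ∘ ⋯ ∘ R_d^{k_d} φ₀)(x) / φ₀(x)`. -/
def Ppoly {d : ℕ} (A B : Matrix (Fin d) (Fin d) ℂ) (h : ℝ) (sqrtA : ℂ)
    (k : Fin d → ℕ) (x : Fin d → ℝ) : ℂ :=
  (((2 : ℝ) ^ (((∑ l, k l : ℕ) : ℝ) / 2) : ℝ) : ℂ) *
    opPow (raiseOp A B h) k (phi0 A B h sqrtA) x / phi0 A B h sqrtA x

/-- The coordinate partial derivative `∂_j` acting on functions on `ℝ^d`. -/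
def pdC {d : ℕ} (j : Fin d) (f : (Fin d → ℝ) → ℂ) : (Fin d → ℝ) → ℂ :=
  fun x => fderiv ℝ f x (Pi.single j 1)

/-- The generating function
`G(x,z) = exp(−⟨conj z, A⁻¹ conj(A) z⟩ + (2/√h) ⟨conj z, A⁻¹ x⟩)`. -/
def Gfun {d : ℕ} (A : Matrix (Fin d) (Fin d) ℂ) (h : ℝ) (x : Fin d → ℝ)
    (z : Fin d → ℂ) : ℂ :=
  Complex.exp
    (-(cinner (fun j => (starRingEnd ℂ) (z j)) ((A⁻¹ * A.map (starRingEnd ℂ)).mulVec z))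
      + (2 / ((Real.sqrt h : ℝ) : ℂ)) *
          cinner (fun j => (starRingEnd ℂ) (z j)) (A⁻¹.mulVec (cvec x)))

/-- The holomorphic partial derivative `∂/∂z_l` of a function on `ℂ^d`. -/
def dz {d : ℕ} (l : Fin d) (f : (Fin d → ℂ) → ℂ) : (Fin d → ℂ) → ℂ :=
  fun z => deriv (fun t => f (Function.update z l t)) (z l)


section OperatorPowers

variable {ι α : Type*} {R : ι → α → α} {S : Set α}

lemma foldr_iterate_mem (hS : ∀ l, ∀ ψ ∈ S, R l ψ ∈ S) (k : ι → ℕ) (L : List ι)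
    {ψ : α} (hψ : ψ ∈ S) : L.foldr (fun l f => (R l)^[k l] ∘ f) id ψ ∈ S := by
  induction L with
  | nil => exact hψ
  | cons a L ih => exact Set.MapsTo.iterate (fun φ hφ => hS a φ hφ) (k a) ih

lemma iterate_apply_comm (hS : ∀ l, ∀ ψ ∈ S, R l ψ ∈ S)
    (hR : ∀ l m, ∀ ψ ∈ S, R l (R m ψ) = R m (R l ψ)) (l m : ι) (n : ℕ) {ψ : α} (hψ : ψ ∈ S) :
    (R m)^[n] (R l ψ) = R l ((R m)^[n] ψ) := by
  induction n generalizing ψ with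
  | zero => rfl
  | succ n ih => rw [Function.iterate_succ_apply, Function.iterate_succ_apply, hR m l ψ hψ,
      ih (hS m ψ hψ)]

lemma foldr_iterate_add_single [DecidableEq ι] (hS : ∀ l, ∀ ψ ∈ S, R l ψ ∈ S)
    (hR : ∀ l m, ∀ ψ ∈ S, R l (R m ψ) = R m (R l ψ)) (k : ι → ℕ) (l : ι) {L : List ι}
    (hL : L.Nodup) {ψ : α} (hψ : ψ ∈ S) :
    L.foldr (fun m f => (R m)^[(k + Pi.single l 1 : ι → ℕ) m] ∘ f) id ψ =
      if l ∈ L then R l (L.foldr (fun m f => (R m)^[k m] ∘ f) id ψ)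
      else L.foldr (fun m f => (R m)^[k m] ∘ f) id ψ := by
  induction L with
  | nil => simp
  | cons a L ih =>
    obtain ⟨ha, hL⟩ := List.nodup_cons.mp hL
    simp only [List.foldr_cons, Function.comp_apply, ih hL]
    by_cases h : l = a
    · subst h
      simp [ha, Function.iterate_succ_apply']
    · by_cases hl : l ∈ L
      · simp [hl, Ne.symm h, iterate_apply_comm hS hR l a (k a) (foldr_iterate_mem hS k L hψ)]
      · simp [hl, h, Ne.symm h]

end OperatorPowers

lemma opPow_add_single {d : ℕ} {α : Type*} {R : Fin d → α → α} {S : Set α}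
    (hS : ∀ l, ∀ ψ ∈ S, R l ψ ∈ S) (hR : ∀ l m, ∀ ψ ∈ S, R l (R m ψ) = R m (R l ψ))
    (k : Fin d → ℕ) (l : Fin d) {ψ : α} (hψ : ψ ∈ S) :
    opPow R (k + Pi.single l 1) ψ = R l (opPow R k ψ) := by
  simpa [opPow] using foldr_iterate_add_single hS hR k l (List.nodup_finRange d) hψ

lemma cinner_mulVec_stdC {d : ℕ} (A : Matrix (Fin d) (Fin d) ℂ) (l : Fin d) (v : Fin d → ℂ) :
    cinner (A.mulVec (stdC l)) v = (Aᴴ.mulVec v) l := by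
  rw [stdC, Matrix.mulVec_single_one]
  simp [cinner, Matrix.mulVec, dotProduct]

lemma hasFDerivAt_cvec {d : ℕ} (i : Fin d) (x : Fin d → ℝ) :
    HasFDerivAt (fun y : Fin d → ℝ => cvec y i)
      (Complex.ofRealCLM.comp (ContinuousLinearMap.proj (R := ℝ) i)) x :=
  (Complex.ofRealCLM.comp
    (ContinuousLinearMap.proj (R := ℝ) (φ := fun _ : Fin d => ℝ) i)).hasFDerivAt

lemma hasFDerivAt_mulVec_cvec {d : ℕ} (M : Matrix (Fin d) (Fin d) ℂ) (i : Fin d)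
    (x : Fin d → ℝ) :
    HasFDerivAt (fun y : Fin d → ℝ => M.mulVec (cvec y) i)
      (∑ j, M i j • Complex.ofRealCLM.comp (ContinuousLinearMap.proj (R := ℝ) j)) x := by
  simp only [Matrix.mulVec, dotProduct]
  exact HasFDerivAt.fun_sum fun j _ => (hasFDerivAt_cvec j x).const_mul (M i j)

lemma contDiff_cvec {d : ℕ} (i : Fin d) {n : WithTop ℕ∞} :
    ContDiff ℝ n (fun y : Fin d → ℝ => cvec y i) :=
  (Complex.ofRealCLM.comp
    (ContinuousLinearMap.proj (R := ℝ) (φ := fun _ : Fin d => ℝ) i)).contDiff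

lemma contDiff_mulVec_cvec {d : ℕ} (M : Matrix (Fin d) (Fin d) ℂ) (i : Fin d) {n : WithTop ℕ∞} :
    ContDiff ℝ n (fun y : Fin d → ℝ => M.mulVec (cvec y) i) := by
  simp only [Matrix.mulVec, dotProduct]
  exact ContDiff.sum fun j _ => contDiff_const.mul (contDiff_cvec j)

lemma grad_mulVec_cvec {d : ℕ} (M : Matrix (Fin d) (Fin d) ℂ) (i j : Fin d) (x : Fin d → ℝ) :
    grad (fun y => M.mulVec (cvec y) i) x j = M i j := by
  simp [grad, (hasFDerivAt_mulVec_cvec M i x).fderiv, Pi.single_apply, apply_ite]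

lemma grad_mul {d : ℕ} {f g : (Fin d → ℝ) → ℂ} {x : Fin d → ℝ} (hf : DifferentiableAt ℝ f x)
    (hg : DifferentiableAt ℝ g x) :
    grad (fun y => f y * g y) x = f x • grad g x + g x • grad f x := by
  ext j
  simp [grad, fderiv_fun_mul hf hg]

lemma grad_sub {d : ℕ} {f g : (Fin d → ℝ) → ℂ} {x : Fin d → ℝ} (hf : DifferentiableAt ℝ f x)
    (hg : DifferentiableAt ℝ g x) :
    grad (fun y => f y - g y) x = grad f x - grad g x := by
  ext j
  simp [grad, fderiv_fun_sub hf hg]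

lemma grad_const_mul {d : ℕ} (c : ℂ) {f : (Fin d → ℝ) → ℂ} {x : Fin d → ℝ}
    (hf : DifferentiableAt ℝ f x) :
    grad (fun y => c * f y) x = c • grad f x := by
  ext j
  simp [grad, fderiv_const_mul hf]

lemma grad_mulVec_grad {d : ℕ} (M : Matrix (Fin d) (Fin d) ℂ) (i j : Fin d)
    {ψ : (Fin d → ℝ) → ℂ} {x : Fin d → ℝ}
    (hψ : ∀ m, DifferentiableAt ℝ (fun y => grad ψ y m) x) :
    grad (fun y => M.mulVec (grad ψ y) i) x j =
      ∑ m, M i m * grad (fun y => grad ψ y m) x j := by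
  simp only [grad, Matrix.mulVec, dotProduct] at hψ ⊢
  rw [fderiv_fun_sum fun m _ => (hψ m).const_mul _]
  simp [fderiv_const_mul (hψ _)]

lemma contDiff_grad_apply {d : ℕ} {ψ : (Fin d → ℝ) → ℂ} (hψ : ContDiff ℝ (⊤ : ℕ∞) ψ)
    (j : Fin d) : ContDiff ℝ (⊤ : ℕ∞) (fun y => grad ψ y j) :=
  (hψ.fderiv_right (m := (⊤ : ℕ∞)) (by simp)).clm_apply contDiff_const

lemma contDiff_mulVec_grad {d : ℕ} (M : Matrix (Fin d) (Fin d) ℂ) (i : Fin d)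
    {ψ : (Fin d → ℝ) → ℂ} (hψ : ContDiff ℝ (⊤ : ℕ∞) ψ) :
    ContDiff ℝ (⊤ : ℕ∞) (fun y => M.mulVec (grad ψ y) i) := by
  simp only [Matrix.mulVec, dotProduct]
  exact ContDiff.sum fun j _ => contDiff_const.mul (contDiff_grad_apply hψ j)

lemma grad_grad_comm {d : ℕ} {ψ : (Fin d → ℝ) → ℂ} (hψ : ContDiff ℝ (⊤ : ℕ∞) ψ) (i j : Fin d)
    (x : Fin d → ℝ) :
    grad (fun y => grad ψ y i) x j = grad (fun y => grad ψ y j) x i := by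
  have hd : DifferentiableAt ℝ (fderiv ℝ ψ) x :=
    (hψ.fderiv_right (m := (⊤ : ℕ∞)) (by simp)).contDiffAt.differentiableAt (by simp)
  have key : ∀ i j, grad (fun y => grad ψ y i) x j =
      fderiv ℝ (fderiv ℝ ψ) x (Pi.single j 1) (Pi.single i 1) := fun i j => by
    simp [grad, fderiv_clm_apply hd (differentiableAt_const _)]
  rw [key, key]
  exact (hψ.contDiffAt.isSymmSndFDerivAt (by simp [ENat.LEInfty.out])) _ _

lemma raiseOp_eq {d : ℕ} (A B : Matrix (Fin d) (Fin d) ℂ) (h : ℝ) (l : Fin d)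
    (ψ : (Fin d → ℝ) → ℂ) :
    raiseOp A B h l ψ = fun x => ((Real.sqrt (2 * h) : ℝ) : ℂ)⁻¹ *
      (Bᴴ.mulVec (cvec x) l * ψ x - (h : ℂ) * Aᴴ.mulVec (grad ψ x) l) := by
  funext x
  simp only [raiseOp, cinner_mulVec_stdC]

lemma contDiff_raiseOp {d : ℕ} (A B : Matrix (Fin d) (Fin d) ℂ) (h : ℝ) (l : Fin d)
    {ψ : (Fin d → ℝ) → ℂ} (hψ : ContDiff ℝ (⊤ : ℕ∞) ψ) :
    ContDiff ℝ (⊤ : ℕ∞) (raiseOp A B h l ψ) := by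
  rw [raiseOp_eq]
  exact contDiff_const.mul (((contDiff_mulVec_cvec _ l).mul hψ).sub
    (contDiff_const.mul (contDiff_mulVec_grad _ l hψ)))

lemma grad_raiseOp {d : ℕ} (A B : Matrix (Fin d) (Fin d) ℂ) (h : ℝ) (l j : Fin d)
    {ψ : (Fin d → ℝ) → ℂ} (hψ : ContDiff ℝ (⊤ : ℕ∞) ψ) (x : Fin d → ℝ) :
    grad (raiseOp A B h l ψ) x j = ((Real.sqrt (2 * h) : ℝ) : ℂ)⁻¹ *
      (Bᴴ.mulVec (cvec x) l * grad ψ x j + ψ x * Bᴴ l j -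
        (h : ℂ) * ∑ m, Aᴴ l m * grad (fun y => grad ψ y m) x j) := by
  have h0 : ((⊤ : ℕ∞) : WithTop ℕ∞) ≠ 0 := by simp
  have hψ' := hψ.differentiable h0 x
  have h1 := (contDiff_mulVec_cvec (n := (⊤ : ℕ∞)) Bᴴ l).differentiable h0 x
  have h2 := (contDiff_mulVec_grad Aᴴ l hψ).differentiable h0 x
  rw [raiseOp_eq, grad_const_mul _ ((h1.fun_mul hψ').fun_sub (h2.const_mul _)),
    grad_sub (h1.fun_mul hψ') (h2.const_mul _), grad_mul h1 hψ', grad_const_mul _ h2]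
  simp only [Pi.smul_apply, Pi.sub_apply, Pi.add_apply, smul_eq_mul, grad_mulVec_cvec,
    grad_mulVec_grad _ _ _ fun m => (contDiff_grad_apply hψ m).differentiable h0 x]

/-- The raising operators commute on smooth functions, since `AᵀB` is symmetric. -/
lemma raiseOp_comm {d : ℕ} {A B : Matrix (Fin d) (Fin d) ℂ} (hAB : Aᵀ * B - Bᵀ * A = 0) (h : ℝ)
    (l m : Fin d) {ψ : (Fin d → ℝ) → ℂ} (hψ : ContDiff ℝ (⊤ : ℕ∞) ψ) :
    raiseOp A B h l (raiseOp A B h m ψ) = raiseOp A B h m (raiseOp A B h l ψ) := by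
  have hsymm : ∑ j, Aᴴ l j * Bᴴ m j = ∑ j, Aᴴ m j * Bᴴ l j := by
    have := congrArg (starRingEnd ℂ) (congrFun₂ (sub_eq_zero.mp hAB) l m)
    simpa [Matrix.mul_apply, Matrix.conjTranspose_apply, mul_comm] using this
  have hexp : ∀ l m x, ∑ j, Aᴴ l j * grad (raiseOp A B h m ψ) x j =
      ((Real.sqrt (2 * h) : ℝ) : ℂ)⁻¹ * (Bᴴ.mulVec (cvec x) m * Aᴴ.mulVec (grad ψ x) l +
        ψ x * ∑ j, Aᴴ l j * Bᴴ m j -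
        (h : ℂ) * ∑ j, ∑ i, Aᴴ l j * Aᴴ m i * grad (fun y => grad ψ y i) x j) := by
    intro l m x
    simp only [grad_raiseOp A B h m _ hψ x, Matrix.mulVec, dotProduct, Finset.mul_sum,
      ← Finset.sum_add_distrib, ← Finset.sum_sub_distrib]
    refine Finset.sum_congr rfl fun j _ => ?_
    simp only [mul_sub, mul_add, Finset.mul_sum]
    congr 1
    · ring
    · exact Finset.sum_congr rfl fun i _ => by ring
  have hsnd : ∀ x, ∑ j, ∑ i, Aᴴ l j * Aᴴ m i * grad (fun y => grad ψ y i) x j =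
      ∑ j, ∑ i, Aᴴ m j * Aᴴ l i * grad (fun y => grad ψ y i) x j := by
    intro x
    rw [Finset.sum_comm]
    refine Finset.sum_congr rfl fun i _ => Finset.sum_congr rfl fun j _ => ?_
    rw [grad_grad_comm hψ i j, mul_comm (Aᴴ l j)]
  rw [raiseOp_eq A B h l, raiseOp_eq A B h m (raiseOp A B h l ψ)]
  funext x
  have e1 := hexp l m x
  have e2 := hexp m l x
  change Aᴴ.mulVec (grad (raiseOp A B h m ψ) x) l = _ at e1
  change Aᴴ.mulVec (grad (raiseOp A B h l ψ) x) m = _ at e2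
  rw [e1, e2, hsymm, hsnd]
  simp only [raiseOp_eq]
  ring

lemma contDiff_phi0 {d : ℕ} (A B : Matrix (Fin d) (Fin d) ℂ) (h : ℝ) (s : ℂ) :
    ContDiff ℝ (⊤ : ℕ∞) (phi0 A B h s) := by
  refine contDiff_const.mul (ContDiff.cexp (ContDiff.neg (ContDiff.div_const ?_ _)))
  have hconj : ∀ (y : Fin d → ℝ) i, (starRingEnd ℂ) (cvec y i) = cvec y i :=
    fun y i => Complex.conj_ofReal _
  simp only [cinner, hconj]
  exact ContDiff.sum fun i _ => (contDiff_cvec i).mul (contDiff_mulVec_cvec _ i)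

lemma phi0_ne_zero {d : ℕ} (A B : Matrix (Fin d) (Fin d) ℂ) {h : ℝ} (hh : 0 < h) {s : ℂ}
    (hs : s ≠ 0) (x : Fin d → ℝ) : phi0 A B h s x ≠ 0 := by
  refine mul_ne_zero (mul_ne_zero ?_ (inv_ne_zero hs)) (Complex.exp_ne_zero _)
  exact_mod_cast (mul_pos (Real.rpow_pos_of_pos Real.pi_pos _) (Real.rpow_pos_of_pos hh _)).ne'

lemma grad_phi0 {d : ℕ} {A B : Matrix (Fin d) (Fin d) ℂ} (hM : (B * A⁻¹)ᵀ = B * A⁻¹) {h : ℝ}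
    (hh : h ≠ 0) (s : ℂ) (x : Fin d → ℝ) :
    grad (phi0 A B h s) x = (-(phi0 A B h s x / h)) • (B * A⁻¹).mulVec (cvec x) := by
  have hh' : (h : ℂ) ≠ 0 := by exact_mod_cast hh
  ext j
  have hconj : ∀ (y : Fin d → ℝ) i, (starRingEnd ℂ) (cvec y i) = cvec y i :=
    fun y i => Complex.conj_ofReal _
  have hquad : HasFDerivAt (fun y : Fin d → ℝ => cinner (cvec y) ((B * A⁻¹).mulVec (cvec y)))
      (∑ i, (cvec x i • (∑ j, (B * A⁻¹) i j •
          Complex.ofRealCLM.comp (ContinuousLinearMap.proj (R := ℝ) j)) +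
        (B * A⁻¹).mulVec (cvec x) i •
          Complex.ofRealCLM.comp (ContinuousLinearMap.proj (R := ℝ) i))) x := by
    simp only [cinner, hconj]
    exact HasFDerivAt.fun_sum fun i _ => (hasFDerivAt_cvec i x).mul
      (hasFDerivAt_mulVec_cvec (B * A⁻¹) i x)
  have hphi := ((hquad.mul_const ((2 * h : ℝ) : ℂ)⁻¹).fun_neg.cexp).const_mul
    (((Real.pi ^ (-(d : ℝ) / 4) * h ^ (-(d : ℝ) / 4) : ℝ) : ℂ) * s⁻¹)
  simp only [← div_eq_mul_inv _ ((2 * h : ℝ) : ℂ)] at hphi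
  have hsum : ∑ i, cvec x i * (B * A⁻¹) i j = (B * A⁻¹).mulVec (cvec x) j := by
    conv_rhs => rw [← hM]
    simp [Matrix.mulVec, dotProduct, mul_comm]
  refine (congrArg (fun L => L (Pi.single j 1)) hphi.fderiv).trans ?_
  simp [Pi.single_apply, apply_ite, Finset.sum_add_distrib, hsum, phi0]
  field_simp
  ring

/-- Conjugating `R_l` with the Gaussian `φ₀`. -/
lemma raiseOp_phi0_mul {d : ℕ} {A B : Matrix (Fin d) (Fin d) ℂ} (hA : IsUnit A.det)
    (hAB₁ : Aᴴ * B + Bᴴ * A = (2 : ℂ) • (1 : Matrix (Fin d) (Fin d) ℂ))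
    (hAB₂ : Aᵀ * B - Bᵀ * A = 0) {h : ℝ} (hh : 0 < h) (s : ℂ) (l : Fin d)
    {q : (Fin d → ℝ) → ℂ} {x : Fin d → ℝ} (hq : DifferentiableAt ℝ q x) :
    raiseOp A B h l (fun y => phi0 A B h s y * q y) x = phi0 A B h s x *
      (((Real.sqrt (2 * h) : ℝ) : ℂ)⁻¹ *
        (2 * A⁻¹.mulVec (cvec x) l * q x - h * Aᴴ.mulVec (grad q x) l)) := by
  have hM : (B * A⁻¹)ᵀ = B * A⁻¹ := by
    have hT : IsUnit Aᵀ.det := by rwa [Matrix.det_transpose]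
    rw [Matrix.transpose_mul, Matrix.transpose_nonsing_inv]
    calc Aᵀ⁻¹ * Bᵀ = Aᵀ⁻¹ * (Bᵀ * A) * A⁻¹ := by
          rw [← Matrix.mul_assoc, Matrix.mul_nonsing_inv_cancel_right _ _ hA]
      _ = B * A⁻¹ := by
          rw [← sub_eq_zero.mp hAB₂, Matrix.nonsing_inv_mul_cancel_left _ _ hT]
  have hsum : Aᴴ * (B * A⁻¹) + Bᴴ = (2 : ℂ) • A⁻¹ := by
    have := congrArg (· * A⁻¹) hAB₁
    simpa [add_mul, Matrix.mul_assoc, Matrix.mul_nonsing_inv _ hA] using this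
  have hl : Aᴴ.mulVec ((B * A⁻¹).mulVec (cvec x)) l + Bᴴ.mulVec (cvec x) l =
      2 * A⁻¹.mulVec (cvec x) l := by
    have := congrArg (fun M => M.mulVec (cvec x) l) hsum
    simpa [Matrix.add_mulVec, Matrix.smul_mulVec] using this
  have hh' : (h : ℂ) ≠ 0 := by exact_mod_cast hh.ne'
  rw [raiseOp_eq]
  simp only
  rw [grad_mul ((contDiff_phi0 A B h s).differentiable (by simp) x) hq,
    grad_phi0 hM hh.ne', ← hl]
  simp only [Matrix.mulVec_add, Matrix.mulVec_smul, Pi.add_apply, Pi.smul_apply, smul_eq_mul]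
  field_simp
  ring

/-- Recursion for the polynomials:
`P_(k+e_l)(A,ℏ,x) = (2/√ℏ) ⟨A e_l, (A A*)⁻¹ x⟩ P_k(A,ℏ,x) − √ℏ ⟨A e_l, ∇ₓ P_k(A,ℏ,x)⟩`. -/
theorem Ppoly_recursion
    {d : ℕ} (hd : 1 ≤ d) {hbar : ℝ} (hhbar : 0 < hbar)
    (A B : Matrix (Fin d) (Fin d) ℂ) (hA : IsUnit A.det) (hB : IsUnit B.det)
    (hAB₁ : Aᴴ * B + Bᴴ * A = (2 : ℂ) • (1 : Matrix (Fin d) (Fin d) ℂ))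
    (hAB₂ : Aᵀ * B - Bᵀ * A = 0)
    (sqrtA : ℂ) (hsqrtA : sqrtA ^ 2 = A.det)
    (k : Fin d → ℕ) (l : Fin d) (x : Fin d → ℝ) :
    Ppoly A B hbar sqrtA (k + Pi.single l 1) x =
      (2 / ((Real.sqrt hbar : ℝ) : ℂ)) *
          cinner (A.mulVec (stdC l)) (((A * Aᴴ)⁻¹).mulVec (cvec x)) *
          Ppoly A B hbar sqrtA k x
        - ((Real.sqrt hbar : ℝ) : ℂ) *
            cinner (A.mulVec (stdC l)) (grad (fun y => Ppoly A B hbar sqrtA k y) x) := by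
  have hs : sqrtA ≠ 0 := fun h0 => hA.ne_zero (by rw [← hsqrtA, h0]; simp)
  have hφ := phi0_ne_zero A B hhbar hs
  have hφs := contDiff_phi0 A B hbar sqrtA
  have hψs : ContDiff ℝ (⊤ : ℕ∞) (opPow (raiseOp A B hbar) k (phi0 A B hbar sqrtA)) :=
    foldr_iterate_mem (S := {ψ | ContDiff ℝ (⊤ : ℕ∞) ψ})
      (fun l ψ hψ => contDiff_raiseOp A B hbar l hψ) k _ hφs
  have hstep : opPow (raiseOp A B hbar) (k + Pi.single l 1) (phi0 A B hbar sqrtA) =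
      raiseOp A B hbar l (opPow (raiseOp A B hbar) k (phi0 A B hbar sqrtA)) :=
    opPow_add_single (S := {ψ | ContDiff ℝ (⊤ : ℕ∞) ψ})
      (fun l ψ hψ => contDiff_raiseOp A B hbar l hψ)
      (fun l m ψ hψ => raiseOp_comm hAB₂ hbar l m hψ) k l hφs
  set ψ := opPow (raiseOp A B hbar) k (phi0 A B hbar sqrtA) with hψ
  set q : (Fin d → ℝ) → ℂ := fun y => ψ y / phi0 A B hbar sqrtA y with hq
  have hqd : DifferentiableAt ℝ q x := by
    simp only [hq, div_eq_mul_inv]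
    exact (hψs.mul (hφs.inv hφ)).differentiable (by simp) x
  have hψq : ψ = fun y => phi0 A B hbar sqrtA y * q y := by
    funext y
    rw [hq]
    field_simp [hφ y]
  have hP : (fun y => Ppoly A B hbar sqrtA k y) =
      fun y => (((2 : ℝ) ^ (((∑ l, k l : ℕ) : ℝ) / 2) : ℝ) : ℂ) * q y := by
    funext y
    simp only [Ppoly, hq, ← hψ, mul_div_assoc]
  have hinv : Aᴴ * (A * Aᴴ)⁻¹ = A⁻¹ := by
    have hAH : IsUnit Aᴴ.det := by rw [Matrix.det_conjTranspose]; exact hA.star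
    rw [Matrix.mul_inv_rev, Matrix.mul_nonsing_inv_cancel_left _ _ hAH]
  have hpow : (2 : ℝ) ^ (((∑ m, (k + Pi.single l 1 : Fin d → ℕ) m : ℕ) : ℝ) / 2) =
      2 ^ (((∑ m, k m : ℕ) : ℝ) / 2) * Real.sqrt 2 := by
    rw [Real.sqrt_eq_rpow, ← Real.rpow_add two_pos]
    congr 1
    simp [Finset.sum_add_distrib]
    ring
  rw [hP, grad_const_mul _ hqd, congrFun hP x]
  rw [Ppoly, hstep, hψq, raiseOp_phi0_mul hA hAB₁ hAB₂ hhbar sqrtA l hqd, hpow,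
    cinner_mulVec_stdC, cinner_mulVec_stdC, Matrix.mulVec_mulVec, hinv, Matrix.mulVec_smul,
    Real.sqrt_mul two_pos.le]
  have h2 : ((Real.sqrt 2 : ℝ) : ℂ) ≠ 0 := by
    exact_mod_cast (Real.sqrt_pos.mpr two_pos).ne'
  have hr : ((Real.sqrt hbar : ℝ) : ℂ) ≠ 0 := by
    exact_mod_cast (Real.sqrt_pos.mpr hhbar).ne'
  have hrr : (hbar : ℂ) = ((Real.sqrt hbar : ℝ) : ℂ) ^ 2 := by
    exact_mod_cast (Real.sq_sqrt hhbar.le).symm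
  have hx := hφ x
  simp only [Pi.smul_apply, smul_eq_mul, Complex.ofReal_mul]
  generalize phi0 A B hbar sqrtA x = p at hx ⊢
  rw [hrr]
  field_simp

end
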